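/- arXiv:2412.10532 — 4 statements merged into one kernel-verified Lean document; each statement's English description precedes it below -/
import Mathlib

section
/- Let n ≥ 2 and 1 ≤ k ≤ n. If I is a consistent subset of the k-element subsets of [n], then the deletion I\n is a consistent subset of the k-element subsets of [n−1], and the contraction I/n is a consistent subset of the (k−1)-element subsets of [n−1]. -/
open Finset

/-- The `k`-element subsets of `[n] = {1, …, n}`. -/
def ksubsets (n k : ℕ) : Finset (Finset ℕ) := (Finset.Icc 1 n).powersetCard k

/-- The packet of `X`: all subsets of `X` with one element removed. -/
def packet (X : Finset ℕ) : Finset (Finset ℕ) := X.image (fun x => X.erase x)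

/-- The copacket of `X` with respect to `[n]`: all sets `X ∪ {i}` for `i ∈ [n] \ X`. -/
def copacket (n : ℕ) (X : Finset ℕ) : Finset (Finset ℕ) :=
  ((Finset.Icc 1 n) \ X).image (fun i => insert i X)

/-- The lexicographic order on finite sets of naturals viewed as increasing lists:
`X < Y` iff there is `m ∈ X \ Y` below which `X` and `Y` agree. -/
def lexLt (X Y : Finset ℕ) : Prop :=
  ∃ m ∈ X, m ∉ Y ∧ ∀ a < m, (a ∈ X ↔ a ∈ Y)

/-- `r` is a strict linear order on the collection `D`. -/
def IsStrictOrdOn (D : Finset (Finset ℕ)) (r : Finset ℕ → Finset ℕ → Prop) : Prop :=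
  (∀ X ∈ D, ¬ r X X) ∧
  (∀ X ∈ D, ∀ Y ∈ D, ∀ Z ∈ D, r X Y → r Y Z → r X Z) ∧
  (∀ X ∈ D, ∀ Y ∈ D, X ≠ Y → r X Y ∨ r Y X)

/-- The restriction of `r` to `P` is the lex order. -/
def RestrLex (r : Finset ℕ → Finset ℕ → Prop) (P : Finset (Finset ℕ)) : Prop :=
  ∀ A ∈ P, ∀ B ∈ P, (r A B ↔ lexLt A B)

/-- The restriction of `r` to `P` is the antilex order. -/
def RestrAntilex (r : Finset ℕ → Finset ℕ → Prop) (P : Finset (Finset ℕ)) : Prop :=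
  ∀ A ∈ P, ∀ B ∈ P, (r A B ↔ lexLt B A)

/-- `r` is an admissible order on the `k`-element subsets of `[n]`. -/
def Admissible (n k : ℕ) (r : Finset ℕ → Finset ℕ → Prop) : Prop :=
  IsStrictOrdOn (ksubsets n k) r ∧
  ∀ X ∈ ksubsets n (k+1), RestrLex r (packet X) ∨ RestrAntilex r (packet X)

/-- `r` is a coadmissible order on the `k`-element subsets of `[n]`. -/
def Coadmissible (n k : ℕ) (r : Finset ℕ → Finset ℕ → Prop) : Prop :=
  IsStrictOrdOn (ksubsets n k) r ∧
  ∀ X ∈ ksubsets n (k-1), RestrLex r (copacket n X) ∨ RestrAntilex r (copacket n X)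

open scoped Classical in
/-- The reversal set of an order on the `k`-element subsets of `[n]`:
the `(k+1)`-element subsets whose packet is restricted to the antilex order. -/
noncomputable def Rev (n k : ℕ) (r : Finset ℕ → Finset ℕ → Prop) : Finset (Finset ℕ) :=
  (ksubsets n (k+1)).filter (fun X => RestrAntilex r (packet X))

open scoped Classical in
/-- The coreversal set of an order on the `k`-element subsets of `[n]`:
the `(k-1)`-element subsets whose copacket is restricted to the antilex order. -/
noncomputable def Corev (n k : ℕ) (r : Finset ℕ → Finset ℕ → Prop) : Finset (Finset ℕ) :=
  (ksubsets n (k-1)).filter (fun X => RestrAntilex r (copacket n X))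

/-- `P ∩ I` is a prefix (lower set) of `P` in lex order. -/
def IsLexPrefix (P I : Finset (Finset ℕ)) : Prop :=
  ∀ A ∈ P, ∀ B ∈ P, B ∈ I → lexLt A B → A ∈ I

/-- `P ∩ I` is a suffix (upper set) of `P` in lex order. -/
def IsLexSuffix (P I : Finset (Finset ℕ)) : Prop :=
  ∀ A ∈ P, ∀ B ∈ P, A ∈ I → lexLt A B → B ∈ I

/-- `I` is a consistent subset of the `k`-element subsets of `[n]`. -/
def Consistent (n k : ℕ) (I : Finset (Finset ℕ)) : Prop :=
  I ⊆ ksubsets n k ∧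
  ∀ X ∈ ksubsets n (k+1), IsLexPrefix (packet X) I ∨ IsLexSuffix (packet X) I

/-- `I` is a coconsistent subset of the `k`-element subsets of `[n]`. -/
def CoConsistent (n k : ℕ) (I : Finset (Finset ℕ)) : Prop :=
  I ⊆ ksubsets n k ∧
  ∀ X ∈ ksubsets n (k-1), IsLexPrefix (copacket n X) I ∨ IsLexSuffix (copacket n X) I

/-- Deletion `I \ n` of a set of subsets. -/
def del (I : Finset (Finset ℕ)) (n : ℕ) : Finset (Finset ℕ) := I.filter (fun X => n ∉ X)

/-- Contraction `I / n` of a set of subsets. -/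
def contr (I : Finset (Finset ℕ)) (n : ℕ) : Finset (Finset ℕ) :=
  (I.filter (fun X => n ∈ X)).image (fun X => X.erase n)

/-- Contraction `ρ / n` of a linear order: `X < Y` iff `X ∪ {n} < Y ∪ {n}` in `ρ`. -/
def contrOrd (r : Finset ℕ → Finset ℕ → Prop) (n : ℕ) : Finset ℕ → Finset ℕ → Prop :=
  fun X Y => r (insert n X) (insert n Y)

/-- The Gale order: componentwise comparison of the increasing enumerations. -/
def galeLe (A B : Finset ℕ) : Prop :=
  List.Forall₂ (· ≤ ·) (A.sort (· ≤ ·)) (B.sort (· ≤ ·))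

/-- The consistent poset relation `≺_I` on the `(k-1)`-element subsets of `[n]`:
within the packet of `X ∈ I` the antilex order, and within the packet of
`X ∉ I` the lex order, transitively closed. -/
def cpRel (n k : ℕ) (I : Finset (Finset ℕ)) : Finset ℕ → Finset ℕ → Prop :=
  Relation.TransGen (fun A B =>
    ∃ X ∈ ksubsets n k, A ∈ packet X ∧ B ∈ packet X ∧
      ((X ∈ I ∧ lexLt B A) ∨ (X ∉ I ∧ lexLt A B)))

/-- A single-step-inclusion cover within the collection `C`. -/
def SSIStep (C : Finset (Finset ℕ) → Prop) (A B : Finset (Finset ℕ)) : Prop :=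
  C A ∧ C B ∧ ∃ Y, Y ∉ A ∧ B = insert Y A

/-- The single step inclusion order on the collection `C`. -/
def SSILe (C : Finset (Finset ℕ) → Prop) : Finset (Finset ℕ) → Finset (Finset ℕ) → Prop :=
  Relation.ReflTransGen (SSIStep C)

theorem mem_ksubsets_pred {n j : ℕ} (hn : 2 ≤ n) {X : Finset ℕ} :
    X ∈ ksubsets (n - 1) j ↔ X ∈ ksubsets n j ∧ n ∉ X := by
  simp only [ksubsets, mem_powersetCard, Finset.subset_iff, mem_Icc]
  constructor
  · rintro ⟨h, hc⟩
    refine ⟨⟨fun x hx => ?_, hc⟩, fun hx => ?_⟩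
    · have := h hx
      omega
    · have := h hx
      omega
  · rintro ⟨⟨h, hc⟩, hx⟩
    refine ⟨fun x hx' => ?_, hc⟩
    have := h hx'
    have : x ≠ n := fun e => hx (e ▸ hx')
    omega

theorem mem_contr_iff {I : Finset (Finset ℕ)} {n : ℕ} {A : Finset ℕ} (hA : n ∉ A) :
    A ∈ contr I n ↔ insert n A ∈ I := by
  simp only [contr, mem_image, mem_filter]
  constructor
  · rintro ⟨X, ⟨hX, hn⟩, rfl⟩
    rwa [insert_erase hn]
  · intro h
    exact ⟨insert n A, ⟨h, mem_insert_self _ _⟩, erase_insert hA⟩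

theorem lexLt_insert {n : ℕ} {A B : Finset ℕ} (hA : n ∉ A) (h : lexLt A B) :
    lexLt (insert n A) (insert n B) := by
  obtain ⟨m, hm, hm', h⟩ := h
  refine ⟨m, mem_insert_of_mem hm, ?_, fun a ha => ?_⟩
  · rw [mem_insert, not_or]
    exact ⟨fun e => hA (e ▸ hm), hm'⟩
  · rw [mem_insert, mem_insert, h a ha]

theorem packet_notMem {n : ℕ} {X A : Finset ℕ} (hX : n ∉ X) (hA : A ∈ packet X) : n ∉ A := by
  simp only [packet, mem_image] at hA
  obtain ⟨x, -, rfl⟩ := hA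
  exact fun h => hX (mem_of_mem_erase h)

theorem packet_insert {n : ℕ} {X A : Finset ℕ} (hX : n ∉ X) (hA : A ∈ packet X) :
    insert n A ∈ packet (insert n X) := by
  simp only [packet, mem_image] at hA ⊢
  obtain ⟨x, hx, rfl⟩ := hA
  refine ⟨x, mem_insert_of_mem hx, ?_⟩
  rw [erase_insert_of_ne]
  exact fun e => hX (e ▸ hx)

/-- If `I` is a consistent subset of the `k`-element subsets of `[n]`
(`n ≥ 2`, `1 ≤ k ≤ n`), then `I \ n` is a consistent subset of the `k`-element
subsets of `[n-1]` and `I / n` is a consistent subset of the `(k-1)`-element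
subsets of `[n-1]`. -/
theorem consistent_deletion_contraction (n k : ℕ) (hn : 2 ≤ n) (hk : 1 ≤ k) (hkn : k ≤ n)
    (I : Finset (Finset ℕ)) (hI : Consistent n k I) :
    Consistent (n - 1) k (del I n) ∧ Consistent (n - 1) (k - 1) (contr I n) := by
  obtain ⟨hs, hc⟩ := hI
  refine ⟨⟨?_, ?_⟩, ⟨?_, ?_⟩⟩
  · intro X hX
    rw [del, mem_filter] at hX
    exact (mem_ksubsets_pred hn).2 ⟨hs hX.1, hX.2⟩
  · intro X hX
    obtain ⟨hX, hnX⟩ := (mem_ksubsets_pred hn).1 hX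
    refine (hc X hX).imp ?_ ?_
    · intro h A hA B hB hBI hAB
      rw [del, mem_filter] at hBI ⊢
      exact ⟨h A hA B hB hBI.1 hAB, packet_notMem hnX hA⟩
    · intro h A hA B hB hAI hAB
      rw [del, mem_filter] at hAI ⊢
      exact ⟨h A hA B hB hAI.1 hAB, packet_notMem hnX hB⟩
  · intro X hX
    simp only [contr, mem_image, mem_filter] at hX
    obtain ⟨Y, ⟨hY, hnY⟩, rfl⟩ := hX
    refine (mem_ksubsets_pred hn).2 ⟨?_, notMem_erase _ _⟩
    have := hs hY
    simp only [ksubsets, mem_powersetCard] at this ⊢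
    exact ⟨(erase_subset _ _).trans this.1, by rw [card_erase_of_mem hnY, this.2]⟩
  · intro X hX
    obtain ⟨hX, hnX⟩ := (mem_ksubsets_pred hn).1 hX
    have hX' : insert n X ∈ ksubsets n (k + 1) := by
      simp only [ksubsets, mem_powersetCard] at hX ⊢
      refine ⟨insert_subset (mem_Icc.2 ⟨by omega, le_rfl⟩) hX.1, ?_⟩
      rw [card_insert_of_notMem hnX, hX.2]
      omega
    refine (hc _ hX').imp ?_ ?_
    · intro h A hA B hB hBI hAB
      have hnA := packet_notMem hnX hA
      rw [mem_contr_iff (packet_notMem hnX hB)] at hBI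
      rw [mem_contr_iff hnA]
      exact h _ (packet_insert hnX hA) _ (packet_insert hnX hB) hBI (lexLt_insert hnA hAB)
    · intro h A hA B hB hAI hAB
      have hnA := packet_notMem hnX hA
      rw [mem_contr_iff hnA] at hAI
      rw [mem_contr_iff (packet_notMem hnX hB)]
      exact h _ (packet_insert hnX hA) _ (packet_insert hnX hB) hAI (lexLt_insert hnA hAB)
end

section
/- Let n ≥ 2 and 2 ≤ k ≤ n. The map from C(n,k) to C(n−1,k) × C(n−1,k−1) sending I to the pair (I\n, I/n) is injective, and its image equals the set of pairs (S,T) with S ∈ C(n−1,k) and T ∈ C(n−1,k−1) such that T is an upper set of the consistent poset relation ≺_S on the (k−1)-element subsets of [n−1]. -/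
open Finset

theorem dc_lex_erase {X : Finset ℕ} {x y : ℕ} (hx : x ∈ X) (hy : y ∈ X) :
    lexLt (X.erase x) (X.erase y) ↔ y < x := by
  unfold lexLt
  constructor
  · rintro ⟨m, hm, hm', h⟩
    simp only [mem_erase] at hm hm' h
    have hmy : m = y := by
      by_contra hne
      exact hm' ⟨hne, hm.2⟩
    subst hmy
    by_contra hlt
    have h1 : x < m := by omega
    have := (h x h1).2 ⟨by omega, hx⟩
    exact this.1 rfl
  · intro h
    refine ⟨y, by simp [hy]; omega, by simp, ?_⟩
    intro a ha
    simp only [mem_erase]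
    constructor
    · rintro ⟨_, h2⟩; exact ⟨by omega, h2⟩
    · rintro ⟨_, h2⟩; exact ⟨by omega, h2⟩

theorem dc_lower_iff (X : Finset ℕ) (I : Finset (Finset ℕ)) :
    IsLexPrefix (packet X) I ↔
      ∀ x ∈ X, ∀ y ∈ X, y < x → X.erase y ∈ I → X.erase x ∈ I := by
  simp only [IsLexPrefix, packet, mem_image, forall_exists_index, and_imp,
    forall_apply_eq_imp_iff₂]
  constructor
  · intro h x hx y hy hlt hI
    exact h x hx y hy hI ((dc_lex_erase hx hy).2 hlt)
  · intro h x hx y hy hI hlt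
    exact h x hx y hy ((dc_lex_erase hx hy).1 hlt) hI

theorem dc_higher_iff (X : Finset ℕ) (I : Finset (Finset ℕ)) :
    IsLexSuffix (packet X) I ↔
      ∀ x ∈ X, ∀ y ∈ X, y < x → X.erase x ∈ I → X.erase y ∈ I := by
  simp only [IsLexSuffix, packet, mem_image, forall_exists_index, and_imp,
    forall_apply_eq_imp_iff₂]
  constructor
  · intro h x hx y hy hlt hI
    exact h x hx y hy hI ((dc_lex_erase hx hy).2 hlt)
  · intro h x hx y hy hI hlt
    exact h x hx y hy ((dc_lex_erase hx hy).1 hlt) hI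

theorem dc_mem_ks {n k : ℕ} {X : Finset ℕ} :
    X ∈ ksubsets n k ↔ (∀ a ∈ X, 1 ≤ a ∧ a ≤ n) ∧ X.card = k := by
  simp [ksubsets, mem_powersetCard, subset_iff]

theorem dc_mem_del {I : Finset (Finset ℕ)} {n : ℕ} {X : Finset ℕ} :
    X ∈ del I n ↔ X ∈ I ∧ n ∉ X := by simp [del]

theorem dc_mem_contr {I : Finset (Finset ℕ)} {n : ℕ} {Y : Finset ℕ} :
    Y ∈ contr I n ↔ n ∉ Y ∧ insert n Y ∈ I := by
  simp only [contr, mem_image, mem_filter]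
  constructor
  · rintro ⟨X, ⟨hX, hn⟩, rfl⟩
    exact ⟨by simp, by rwa [insert_erase hn]⟩
  · rintro ⟨hn, hI⟩
    exact ⟨_, ⟨hI, by simp⟩, by simp [hn]⟩

theorem dc_ks_notMem {m k : ℕ} {X : Finset ℕ} (h : X ∈ ksubsets m k) : m + 1 ∉ X := by
  intro hm
  have := ((dc_mem_ks.1 h).1 _ hm).2
  omega

theorem dc_ks_succ {m k : ℕ} {X : Finset ℕ} (h : X ∈ ksubsets m k) : X ∈ ksubsets (m + 1) k := by
  rw [dc_mem_ks] at *
  exact ⟨fun a ha => ⟨(h.1 a ha).1, by have := (h.1 a ha).2; omega⟩, h.2⟩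

theorem dc_ks_of {m k : ℕ} {X : Finset ℕ} (h : X ∈ ksubsets (m + 1) k) (hm : m + 1 ∉ X) :
    X ∈ ksubsets m k := by
  rw [dc_mem_ks] at *
  refine ⟨fun a ha => ⟨(h.1 a ha).1, ?_⟩, h.2⟩
  have := (h.1 a ha).2
  have : a ≠ m + 1 := by rintro rfl; exact hm ha
  omega

theorem dc_ks_insert {m k : ℕ} {X : Finset ℕ} (hm : m + 1 ∉ X) :
    insert (m + 1) X ∈ ksubsets (m + 1) (k + 1) ↔ X ∈ ksubsets m k := by
  constructor
  · intro h
    apply dc_ks_of _ hm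
    rw [dc_mem_ks] at *
    rw [card_insert_of_notMem hm] at h
    exact ⟨fun a ha => h.1 a (mem_insert_of_mem ha), by omega⟩
  · intro h
    rw [dc_mem_ks] at *
    rw [card_insert_of_notMem hm]
    refine ⟨fun a ha => ?_, by omega⟩
    rcases mem_insert.1 ha with rfl | ha
    · omega
    · have := h.1 a ha; omega

/-- Consistency at the packet of `Y ∪ {m+1}` in terms of deletion and contraction. -/
theorem dc_key {m k : ℕ} (I : Finset (Finset ℕ)) {Y : Finset ℕ} (hY : Y ∈ ksubsets m k) :
    (IsLexPrefix (packet (insert (m + 1) Y)) I ∨ IsLexSuffix (packet (insert (m + 1) Y)) I) ↔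
      ((Y ∈ del I (m + 1) → IsLexPrefix (packet Y) (contr I (m + 1))) ∧
        (Y ∉ del I (m + 1) → IsLexSuffix (packet Y) (contr I (m + 1)))) := by
  have hm := dc_ks_notMem hY
  have hlt : ∀ a ∈ Y, a < m + 1 := fun a ha => by
    have := ((dc_mem_ks.1 hY).1 a ha).2
    omega
  have hD : Y ∈ del I (m + 1) ↔ Y ∈ I := by simp [dc_mem_del, hm]
  have hE : ∀ a ∈ Y, (insert (m + 1) Y).erase a ∈ I ↔ Y.erase a ∈ contr I (m + 1) := by
    intro a ha
    have := hlt a ha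
    rw [dc_mem_contr, erase_insert_of_ne (by omega)]
    simp [hm]
  have hL : (insert (m + 1) Y).erase (m + 1) = Y := erase_insert hm
  have hP : IsLexPrefix (packet (insert (m + 1) Y)) I ↔
      (IsLexPrefix (packet Y) (contr I (m + 1)) ∧ ∀ y ∈ Y, Y.erase y ∈ contr I (m + 1) → Y ∈ I) := by
    rw [dc_lower_iff, dc_lower_iff]
    constructor
    · intro h
      constructor
      · intro x hx y hy hxy hI
        rw [← hE x hx]; rw [← hE y hy] at hI
        exact h x (by simp [hx]) y (by simp [hy]) hxy hI
      · intro y hy hI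
        rw [← hE y hy] at hI
        have := h (m + 1) (by simp) y (by simp [hy]) (hlt y hy) hI
        rwa [hL] at this
    · rintro ⟨h1, h2⟩ x hx y hy hxy hI
      rcases mem_insert.1 hx with rfl | hx
      · rcases mem_insert.1 hy with rfl | hy
        · omega
        · rw [hL]; exact h2 y hy ((hE y hy).1 hI)
      · rcases mem_insert.1 hy with rfl | hy
        · have := hlt x hx; omega
        · exact (hE x hx).2 (h1 x hx y hy hxy ((hE y hy).1 hI))
  have hS : IsLexSuffix (packet (insert (m + 1) Y)) I ↔
      (IsLexSuffix (packet Y) (contr I (m + 1)) ∧ ∀ y ∈ Y, Y ∈ I → Y.erase y ∈ contr I (m + 1)) := by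
    rw [dc_higher_iff, dc_higher_iff]
    constructor
    · intro h
      constructor
      · intro x hx y hy hxy hI
        rw [← hE y hy]; rw [← hE x hx] at hI
        exact h x (by simp [hx]) y (by simp [hy]) hxy hI
      · intro y hy hI
        rw [← hE y hy]
        exact h (m + 1) (by simp) y (by simp [hy]) (hlt y hy) (by rwa [hL])
    · rintro ⟨h1, h2⟩ x hx y hy hxy hI
      rcases mem_insert.1 hx with rfl | hx
      · rcases mem_insert.1 hy with rfl | hy
        · omega
        · rw [hL] at hI; exact (hE y hy).2 (h2 y hy hI)
      · rcases mem_insert.1 hy with rfl | hy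
        · have := hlt x hx; omega
        · exact (hE y hy).2 (h1 x hx y hy hxy ((hE x hx).1 hI))
  rw [hP, hS, hD, dc_lower_iff, dc_higher_iff]
  by_cases hYI : Y ∈ I
  · simp only [hYI, implies_true, and_true, forall_const, not_true_eq_false, false_imp_iff,
      true_imp_iff]
    constructor
    · rintro (h | ⟨_, h⟩)
      · exact h
      · intro x hx y hy _ _; exact h x hx
    · exact Or.inl
  · simp only [hYI, implies_true, and_true, not_false_eq_true, false_imp_iff, true_imp_iff,
      true_and, imp_false]
    constructor
    · rintro (⟨_, h⟩ | h)
      · intro x hx y hy _ h'; exact absurd h' (h x hx)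
      · exact h
    · exact Or.inr

theorem dc_packet_del {I : Finset (Finset ℕ)} {n : ℕ} {X : Finset ℕ} (h : n ∉ X) :
    (IsLexPrefix (packet X) (del I n) ↔ IsLexPrefix (packet X) I) ∧
      (IsLexSuffix (packet X) (del I n) ↔ IsLexSuffix (packet X) I) := by
  have hE : ∀ a, X.erase a ∈ del I n ↔ X.erase a ∈ I := by
    intro a; simp [dc_mem_del, h]
  simp only [dc_lower_iff, dc_higher_iff, hE, and_self]

theorem dc_upper {m k : ℕ} {S T : Finset (Finset ℕ)} :
    (∀ A B, cpRel m k S A B → A ∈ T → B ∈ T) ↔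
      ∀ Y ∈ ksubsets m k, (Y ∈ S → IsLexPrefix (packet Y) T) ∧
        (Y ∉ S → IsLexSuffix (packet Y) T) := by
  constructor
  · intro h Y hY
    constructor
    · intro hS A hA B hB hBT hlt
      exact h B A (Relation.TransGen.single ⟨Y, hY, hB, hA, Or.inl ⟨hS, hlt⟩⟩) hBT
    · intro hS A hA B hB hAT hlt
      exact h A B (Relation.TransGen.single ⟨Y, hY, hA, hB, Or.inr ⟨hS, hlt⟩⟩) hAT
  · intro h A B hAB
    induction hAB with
    | single hs =>
      obtain ⟨X, hX, hA, hB, ⟨hS, hl⟩ | ⟨hS, hl⟩⟩ := hs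
      · exact fun hT => (h X hX).1 hS _ hB _ hA hT hl
      · exact fun hT => (h X hX).2 hS _ hA _ hB hT hl
    | tail _ hs ih =>
      intro hT
      have hT := ih hT
      obtain ⟨X, hX, hA, hB, ⟨hS, hl⟩ | ⟨hS, hl⟩⟩ := hs
      · exact (h X hX).1 hS _ hB _ hA hT hl
      · exact (h X hX).2 hS _ hA _ hB hT hl

theorem dc_consistent {m j : ℕ} (I : Finset (Finset ℕ)) :
    Consistent (m + 1) (j + 1) I ↔
      (Consistent m (j + 1) (del I (m + 1)) ∧ Consistent m j (contr I (m + 1)) ∧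
        ∀ A B, cpRel m (j + 1) (del I (m + 1)) A B →
          A ∈ contr I (m + 1) → B ∈ contr I (m + 1)) := by
  rw [dc_upper]
  constructor
  · rintro ⟨h1, h2⟩
    have key : ∀ Y ∈ ksubsets m (j + 1), _ := fun Y hY =>
      (dc_key I hY).1 (h2 _ ((dc_ks_insert (dc_ks_notMem hY)).2 hY))
    refine ⟨⟨?_, ?_⟩, ⟨?_, ?_⟩, key⟩
    · intro X hX
      rw [dc_mem_del] at hX
      exact dc_ks_of (h1 hX.1) hX.2
    · intro X hX
      rw [(dc_packet_del (dc_ks_notMem hX)).1, (dc_packet_del (dc_ks_notMem hX)).2]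
      exact h2 X (dc_ks_succ hX)
    · intro Y hY
      rw [dc_mem_contr] at hY
      exact (dc_ks_insert hY.1).1 (h1 hY.2)
    · intro Y hY
      by_cases hS : Y ∈ del I (m + 1)
      · exact Or.inl ((key Y hY).1 hS)
      · exact Or.inr ((key Y hY).2 hS)
  · rintro ⟨⟨h1, h2⟩, ⟨h3, _⟩, key⟩
    constructor
    · intro X hX
      by_cases hm : m + 1 ∈ X
      · rw [← insert_erase hm] at hX ⊢
        have hne : m + 1 ∉ X.erase (m + 1) := by simp
        exact (dc_ks_insert hne).2 (h3 (dc_mem_contr.2 ⟨hne, hX⟩))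
      · exact dc_ks_succ (h1 (dc_mem_del.2 ⟨hX, hm⟩))
    · intro X hX
      by_cases hm : m + 1 ∈ X
      · rw [← insert_erase hm] at hX ⊢
        have hne : m + 1 ∉ X.erase (m + 1) := by simp
        have hY := (dc_ks_insert hne).1 hX
        exact (dc_key I hY).2 (key _ hY)
      · rw [← (dc_packet_del hm).1, ← (dc_packet_del hm).2]
        exact h2 X (dc_ks_of hX hm)

/-- The map `I ↦ (I \ n, I / n)` on consistent subsets of the
`k`-element subsets of `[n]` (`n ≥ 2`, `2 ≤ k ≤ n`) is injective, and a pair `(S, T)`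
is in its image iff `S` is consistent, `T` is consistent, and `T` is an upper set
of the consistent poset relation `≺_S` on the `(k-1)`-element subsets of `[n-1]`. -/
theorem deletion_contraction_injective_image (n k : ℕ) (hn : 2 ≤ n) (hk : 2 ≤ k) (hkn : k ≤ n) :
    (∀ I J : Finset (Finset ℕ), Consistent n k I → Consistent n k J →
        del I n = del J n → contr I n = contr J n → I = J) ∧
    (∀ S T : Finset (Finset ℕ),
        (∃ I, Consistent n k I ∧ del I n = S ∧ contr I n = T) ↔
          (Consistent (n - 1) k S ∧ Consistent (n - 1) (k - 1) T ∧
            ∀ A B, cpRel (n - 1) k S A B → A ∈ T → B ∈ T)) := by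
  obtain ⟨m, rfl⟩ : ∃ m, n = m + 1 := ⟨n - 1, by omega⟩
  obtain ⟨j, rfl⟩ : ∃ j, k = j + 1 := ⟨k - 1, by omega⟩
  simp only [Nat.add_sub_cancel]
  constructor
  · intro I J _ _ hd hc
    ext X
    by_cases hm : m + 1 ∈ X
    · have h := congrArg (fun s => X.erase (m + 1) ∈ s) hc
      simpa [dc_mem_contr, insert_erase hm] using h
    · have h := congrArg (fun s => X ∈ s) hd
      simpa [dc_mem_del, hm] using h
  · intro S T
    constructor
    · rintro ⟨I, hI, rfl, rfl⟩
      exact (dc_consistent I).1 hI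
    · rintro ⟨hS, hT, hU⟩
      have hSn : ∀ X ∈ S, m + 1 ∉ X := fun X hX => dc_ks_notMem (hS.1 hX)
      have hTn : ∀ X ∈ T, m + 1 ∉ X := fun X hX => dc_ks_notMem (hT.1 hX)
      have hd : del (S ∪ T.image (insert (m + 1))) (m + 1) = S := by
        ext X
        simp only [dc_mem_del, mem_union, mem_image]
        constructor
        · rintro ⟨h | ⟨Y, _, rfl⟩, hm⟩
          · exact h
          · simp at hm
        · exact fun h => ⟨Or.inl h, hSn X h⟩
      have hc : contr (S ∪ T.image (insert (m + 1))) (m + 1) = T := by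
        ext X
        simp only [dc_mem_contr, mem_union, mem_image]
        constructor
        · rintro ⟨hm, h | ⟨Y, hY, he⟩⟩
          · exact absurd (mem_insert_self _ _) (hSn _ h)
          · have h := congrArg (fun s => s.erase (m + 1)) he
            simp only [erase_insert hm, erase_insert (hTn Y hY)] at h
            rwa [← h]
        · exact fun h => ⟨hTn X h, Or.inr ⟨X, h, rfl⟩⟩
      refine ⟨S ∪ T.image (insert (m + 1)), ?_, hd, hc⟩
      rw [dc_consistent, hd, hc]
      exact ⟨hS, hT, hU⟩
end

section
/- For integers 1 ≤ k < n, every upper set of the Gale order on the k-element subsets of [n] is a consistent subset of the k-element subsets of [n]. -/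
open Finset

theorem forall2_shift (a : ℕ) : ∀ (t : List ℕ) (x : ℕ), (x :: t).Pairwise (· ≤ ·) → a ∈ t →
    List.Forall₂ (· ≤ ·) (x :: t.erase a) t := by
  intro t
  induction t with
  | nil => intro x _ h; simp at h
  | cons y t ih =>
    intro x hs ha
    have hxy : x ≤ y := (List.pairwise_cons.1 hs).1 y (by simp)
    have hs' := (List.pairwise_cons.1 hs).2
    by_cases hya : y = a
    · subst hya
      rw [List.erase_cons_head]
      exact List.Forall₂.cons hxy (List.forall₂_same.2 (fun _ _ => le_rfl))
    · rw [List.erase_cons_tail (by simpa using hya)]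
      have : a ∈ t := by
        rcases List.mem_cons.1 ha with h | h
        · exact absurd h.symm hya
        · exact h
      exact List.Forall₂.cons hxy (ih y hs' this)

theorem forall2_erase (a b : ℕ) (hba : b < a) : ∀ (l : List ℕ), l.Pairwise (· ≤ ·) → a ∈ l → b ∈ l →
    List.Forall₂ (· ≤ ·) (l.erase a) (l.erase b) := by
  intro l
  induction l with
  | nil => intro _ h; simp at h
  | cons x t ih =>
    intro hs ha hb
    have hs' := List.pairwise_cons.1 hs
    by_cases hxb : x = b
    · subst hxb
      rw [List.erase_cons_head, List.erase_cons_tail (by simpa using hba.ne)]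
      refine forall2_shift a t x hs ?_
      rcases List.mem_cons.1 ha with h | h
      · omega
      · exact h
    · have hbt : b ∈ t := by
        rcases List.mem_cons.1 hb with h | h
        · exact absurd h.symm hxb
        · exact h
      have hxb' := hs'.1 b hbt
      have hxa : x ≠ a := by omega
      have hat : a ∈ t := by
        rcases List.mem_cons.1 ha with h | h
        · exact absurd h.symm hxa
        · exact h
      rw [List.erase_cons_tail (by simpa using hxa), List.erase_cons_tail (by simpa using hxb)]
      exact List.Forall₂.cons le_rfl (ih hs'.2 hat hbt)

theorem sort_erase_eq (X : Finset ℕ) (a : ℕ) :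
    (X.erase a).sort (· ≤ ·) = (X.sort (· ≤ ·)).erase a := by
  refine List.Perm.eq_of_pairwise (le := (· ≤ ·)) (fun _ _ _ _ h1 h2 => le_antisymm h1 h2)
    (Finset.pairwise_sort _ _) ((Finset.pairwise_sort X (· ≤ ·)).sublist List.erase_sublist) ?_
  rw [List.perm_ext_iff_of_nodup (Finset.sort_nodup _ _) ((Finset.sort_nodup X (· ≤ ·)).erase a)]
  intro c
  rw [(Finset.sort_nodup X (· ≤ ·)).mem_erase_iff]
  simp

/-- For `1 ≤ k < n`, every upper set of the Gale order on the
`k`-element subsets of `[n]` is a consistent subset. -/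
theorem gale_upper_set_consistent (n k : ℕ) (hk : 1 ≤ k) (hkn : k < n)
    (J : Finset (Finset ℕ)) (hJ : J ⊆ ksubsets n k)
    (hup : ∀ A ∈ ksubsets n k, ∀ B ∈ ksubsets n k, galeLe A B → A ∈ J → B ∈ J) :
    Consistent n k J := by
  refine ⟨hJ, fun X hX => Or.inr ?_⟩
  intro A hA B hB hAJ hlt
  obtain ⟨hXs, hXc⟩ := Finset.mem_powersetCard.1 hX
  obtain ⟨a, ha, rfl⟩ := Finset.mem_image.1 hA
  obtain ⟨b, hb, rfl⟩ := Finset.mem_image.1 hB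
  have hmem : ∀ c ∈ X, X.erase c ∈ ksubsets n k := fun c hc =>
    Finset.mem_powersetCard.2 ⟨(Finset.erase_subset _ _).trans hXs, by
      rw [Finset.card_erase_of_mem hc, hXc]; rfl⟩
  obtain ⟨m, hm, hm', hag⟩ := hlt
  have hmb : m = b := by
    by_contra h
    exact hm' (Finset.mem_erase.2 ⟨h, (Finset.mem_erase.1 hm).2⟩)
  subst hmb
  have hma : m ≠ a := (Finset.mem_erase.1 hm).1
  have hlt : m < a := by
    by_contra h
    have h2 : a < m := by omega
    have := (hag a h2).2 (Finset.mem_erase.2 ⟨h2.ne, ha⟩)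
    simp at this
  refine hup _ (hmem a ha) _ (hmem m hb) ?_ hAJ
  unfold galeLe
  rw [sort_erase_eq, sort_erase_eq]
  exact forall2_erase a m hlt _ (Finset.pairwise_sort _ _) (by simpa using ha) (by simpa using hb)
end

section
/- For every integer n ≥ 4, the number of coconsistent subsets of the 2-element subsets of [n] equals 2^n + n·2^{n−2} − 2n. (Equivalently, since the higher Bruhat order B(n,n−3) is in bijection with these coconsistent subsets, |B(n,n−3)| = 2^n + n·2^{n−2} − 2n.) -/
open Finset

namespace CoC

abbrev Rel := ℕ → ℕ → Prop

def Sup (p q : ℕ) (a : Rel) : Prop :=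
  (∀ i j, a i j → a j i) ∧ (∀ i, ¬ a i i) ∧ (∀ i j, a i j → p < i ∧ i ≤ q)

def DecRow (p i : ℕ) (a : Rel) : Prop :=
  ∀ j j', p < j → j < j' → j ≠ i → a i j' → a i j

def IncRow (q i : ℕ) (a : Rel) : Prop :=
  ∀ j j', j < j' → j' ≤ q → j' ≠ i → a i j → a i j'

def Dec (p q : ℕ) : Set Rel := {a | Sup p q a ∧ ∀ i, DecRow p i a}
def Inc (p q : ℕ) : Set Rel := {a | Sup p q a ∧ ∀ i, IncRow q i a}

/-- lattice-path type relations -/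
def Yng (p k r q : ℕ) : Set Rel :=
  {b | (∀ i j, b i j → p < i ∧ i ≤ k ∧ r < j ∧ j ≤ q) ∧
    (∀ i j j', r < j → j < j' → b i j' → b i j) ∧
    (∀ i i' j, i < i' → i' ≤ k → b i j → b i' j)}

def SS (k n : ℕ) : Set Rel :=
  {a | Sup 0 n a ∧ (∀ i ≤ k, DecRow 0 i a) ∧ (∀ i, k < i → IncRow n i a)}

def FF (n : ℕ) : Set Rel :=
  {a | Sup 0 n a ∧ ∀ i, 0 < i → i ≤ n → DecRow 0 i a ∨ IncRow n i a}

lemma ext2 {a b : Rel} (h : ∀ i j, a i j ↔ b i j) : a = b := by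
  funext i j; exact propext (h i j)

lemma app2 {a b : Rel} (h : a = b) (i j : ℕ) : a i j ↔ b i j := by rw [h]

lemma dec_card (m : ℕ) : ∀ p, (Dec p (p + m + 1)).encard = ((2 ^ m : ℕ) : ℕ∞) := by
  induction m with
  | zero =>
    intro p
    have : Dec p (p + 0 + 1) = {fun _ _ => False} := by
      ext a
      simp only [Set.mem_singleton_iff]
      constructor
      · rintro ⟨⟨h1, h2, h3⟩, -⟩
        refine ext2 fun i j => ⟨fun h => ?_, False.elim⟩
        have e1 := h3 _ _ h
        have e2 := h3 _ _ (h1 _ _ h)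
        have : i = j := by omega
        subst this
        exact h2 _ h
      · rintro rfl
        exact ⟨⟨by simp, by simp, by simp⟩, fun i => by simp [DecRow]⟩
    rw [this]; simp
  | succ m ih =>
    intro p
    set f : Rel → Rel := fun a i j => a i j ∨ (i = p + 1 ∧ p + 1 < j ∧ j ≤ p + m + 2) ∨
      (j = p + 1 ∧ p + 1 < i ∧ i ≤ p + m + 2) with hf
    have key : Dec p (p + (m + 1) + 1) = Dec p (p + m + 1) ∪ f '' (Dec (p + 1) (p + 1 + m + 1)) := by
      ext a
      constructor
      · rintro ⟨⟨h1, h2, h3⟩, h4⟩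
        by_cases h : a (p + 1) (p + m + 2)
        · right
          refine ⟨fun i j => a i j ∧ i ≠ p + 1 ∧ j ≠ p + 1, ⟨⟨?_, ?_, ?_⟩, ?_⟩, ?_⟩
          · grind
          · grind
          · grind
          · intro i j j' a1 a2 a3 a4
            have := h4 i j j'
            grind
          · refine ext2 fun i j => ?_
            have e1 : ∀ j, p + 1 < j → j ≤ p + m + 2 → a (p + 1) j := by
              intro j b1 b2
              rcases Nat.lt_or_ge j (p + m + 2) with h' | h'
              · exact h4 (p + 1) j (p + m + 2) (by omega) h' (by omega) h
              · have : j = p + m + 2 := by omega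
                rw [this]; exact h
            simp only [hf]
            constructor
            · rintro (⟨h, -⟩ | ⟨rfl, h5, h6⟩ | ⟨rfl, h5, h6⟩)
              · exact h
              · exact e1 _ h5 h6
              · exact h1 _ _ (e1 _ h5 h6)
            · intro h
              have := h3 _ _ h
              have := h3 _ _ (h1 _ _ h)
              by_cases c1 : i = p + 1
              · subst c1
                have : j ≠ p + 1 := by rintro rfl; exact h2 _ h
                right; left; omega
              · by_cases c2 : j = p + 1
                · right; right; omega
                · left; exact ⟨h, c1, c2⟩
        · left
          refine ⟨⟨h1, h2, ?_⟩, h4⟩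
          have e : ∀ j, ¬ a (p + m + 2) j := by
            intro j hj
            have := h3 _ _ (h1 _ _ hj)
            apply h
            apply h1
            rcases Nat.lt_or_ge (p + 1) j with h' | h'
            · exact h4 _ (p + 1) j (by omega) h' (by omega) hj
            · have : j = p + 1 := by omega
              rw [← this]; exact hj
          intro i j hij
          have := h3 _ _ hij
          refine ⟨this.1, ?_⟩
          by_contra hc
          have : i = p + m + 2 := by omega
          subst this
          exact e _ hij
      · rintro (⟨⟨h1, h2, h3⟩, h4⟩ | ⟨a, ⟨⟨h1, h2, h3⟩, h4⟩, rfl⟩)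
        · exact ⟨⟨h1, h2, by grind⟩, h4⟩
        · refine ⟨⟨by grind, by grind, by grind⟩, ?_⟩
          intro i j j' a1 a2 a3 a4
          have := h4 i j j'
          grind
    have hd : Disjoint (Dec p (p + m + 1)) (f '' (Dec (p + 1) (p + 1 + m + 1))) := by
      rw [Set.disjoint_left]
      rintro _ ⟨⟨h1, h2, h3⟩, h4⟩ ⟨a, -, rfl⟩
      have := h3 (p + m + 2) (p + 1) (Or.inr (Or.inr ⟨rfl, by omega, by omega⟩))
      omega
    have hi : Set.InjOn f (Dec (p + 1) (p + 1 + m + 1)) := by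
      rintro a ⟨⟨h1, h2, h3⟩, h4⟩ b ⟨⟨h1', h2', h3'⟩, h4'⟩ hab
      refine ext2 fun i j => ?_
      have := app2 hab i j
      simp only [hf] at this
      grind
    rw [key, Set.encard_union_eq hd, hi.encard_image, ih p, ih (p + 1)]
    norm_cast
    ring

lemma inc_card (m p : ℕ) : (Inc p (p + m + 1)).encard = ((2 ^ m : ℕ) : ℕ∞) := by
  set q := p + m + 1 with hq
  set f : Rel → Rel := fun a i j => (i ≤ p + q ∧ j ≤ p + q) ∧ a (p + q + 1 - i) (p + q + 1 - j) with hf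
  have hfs : ∀ a, Sup p q a → Sup p q (f a) := by
    rintro a ⟨h1, h2, h3⟩
    refine ⟨?_, ?_, ?_⟩
    · rintro i j ⟨h, h'⟩; exact ⟨h.symm, h1 _ _ h'⟩
    · rintro i ⟨h, h'⟩; exact h2 _ h'
    · rintro i j ⟨h, h'⟩; have := h3 _ _ h'; omega
  have hff : ∀ a, Sup p q a → f (f a) = a := by
    rintro a ⟨h1, h2, h3⟩
    refine ext2 fun i j => ⟨?_, ?_⟩
    · rintro ⟨h, h', h''⟩
      have e1 : p + q + 1 - (p + q + 1 - i) = i := by omega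
      have e2 : p + q + 1 - (p + q + 1 - j) = j := by omega
      rwa [e1, e2] at h''
    · intro h
      have := h3 _ _ h
      have := h3 _ _ (h1 _ _ h)
      refine ⟨by omega, by omega, ?_⟩
      have e1 : p + q + 1 - (p + q + 1 - i) = i := by omega
      have e2 : p + q + 1 - (p + q + 1 - j) = j := by omega
      rwa [e1, e2]
  have key : Inc p q = f '' (Dec p q) := by
    ext a
    constructor
    · rintro ⟨h, h4⟩
      refine ⟨f a, ⟨hfs a h, ?_⟩, hff a h⟩
      rintro i j j' a1 a2 a3 ⟨a4, a5⟩
      have := h.2.2 _ _ a5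
      refine ⟨by omega, h4 _ _ _ ?_ ?_ ?_ a5⟩ <;> omega
    · rintro ⟨a, ⟨h, h4⟩, rfl⟩
      refine ⟨hfs a h, ?_⟩
      rintro i j j' a1 a2 a3 ⟨a4, a5⟩
      have := h.2.2 _ _ a5
      have := h.2.2 _ _ (h.1 _ _ a5)
      refine ⟨by omega, h4 _ _ _ ?_ ?_ ?_ a5⟩ <;> omega
  have hi : Set.InjOn f (Dec p q) := by
    rintro a ⟨h, -⟩ b ⟨h', -⟩ hab
    rw [← hff a h, ← hff b h', hab]
  rw [key, hi.encard_image, dec_card]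

lemma yng_card (s : ℕ) : ∀ u v p r, u + v = s →
    (Yng p (p + u) r (r + v)).encard = ((Nat.choose (u + v) u : ℕ) : ℕ∞) := by
  have base : ∀ u v p r, u = 0 ∨ v = 0 → (Yng p (p + u) r (r + v)) = {fun _ _ => False} := by
    intro u v p r huv
    ext a
    simp only [Set.mem_singleton_iff]
    constructor
    · rintro ⟨h1, -⟩
      refine ext2 fun i j => ⟨fun h => ?_, False.elim⟩
      have := h1 _ _ h
      omega
    · rintro rfl
      exact ⟨by simp, by simp, by simp⟩
  induction s with
  | zero =>
    intro u v p r h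
    rw [base u v p r (by omega)]
    have : u = 0 := by omega
    have : v = 0 := by omega
    subst u v; simp
  | succ s ih =>
    intro u v p r h
    rcases u with _ | u
    · rw [base _ v p r (by omega)]; simp
    rcases v with _ | v
    · rw [base _ _ p r (by omega)]; simp
    set f : Rel → Rel := fun b i j => b i j ∨ (p < i ∧ i ≤ p + (u + 1) ∧ j = r + 1) with hf
    have key : Yng p (p + (u + 1)) r (r + (v + 1)) =
        Yng (p + 1) (p + 1 + u) r (r + (v + 1)) ∪ f '' (Yng p (p + (u + 1)) (r + 1) (r + 1 + v)) := by
      ext a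
      constructor
      · rintro ⟨h1, h2, h3⟩
        by_cases h : a (p + 1) (r + 1)
        · right
          refine ⟨fun i j => a i j ∧ j ≠ r + 1, ⟨?_, ?_, ?_⟩, ?_⟩
          · grind
          · intro i j j'
            have := h2 i j j'
            grind
          · intro i i' j
            have := h3 i i' j
            grind
          · refine ext2 fun i j => ?_
            have e1 : ∀ i, p < i → i ≤ p + (u + 1) → a i (r + 1) := by
              intro i b1 b2
              rcases Nat.lt_or_ge (p + 1) i with h' | h'
              · exact h3 (p + 1) i _ h' b2 h
              · have : i = p + 1 := by omega
                rw [this]; exact h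
            simp only [hf]
            have := e1 i
            have := h1 i j
            grind
        · left
          have e : ∀ j, ¬ a (p + 1) j := by
            intro j hj
            have := h1 _ _ hj
            apply h
            rcases Nat.lt_or_ge (r + 1) j with h' | h'
            · exact h2 _ _ _ (by omega) h' hj
            · have : j = r + 1 := by omega
              rw [← this]; exact hj
          refine ⟨?_, h2, ?_⟩
          · intro i j hij
            have := h1 _ _ hij
            have : i ≠ p + 1 := by rintro rfl; exact e _ hij
            omega
          · intro i i' j b1 b2 b3
            exact h3 i i' j b1 (by omega) b3
      · rintro (⟨h1, h2, h3⟩ | ⟨a, ⟨h1, h2, h3⟩, rfl⟩)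
        · refine ⟨by grind, h2, ?_⟩
          intro i i' j b1 b2 b3
          exact h3 i i' j b1 (by omega) b3
        · refine ⟨by grind, ?_, ?_⟩
          · intro i j j'
            have := h2 i j j'
            have := h1 i j'
            grind
          · intro i i' j
            have := h3 i i' j
            grind
    have hd : Disjoint (Yng (p + 1) (p + 1 + u) r (r + (v + 1)))
        (f '' (Yng p (p + (u + 1)) (r + 1) (r + 1 + v))) := by
      rw [Set.disjoint_left]
      rintro _ ⟨h1, -⟩ ⟨a, -, rfl⟩
      have := h1 (p + 1) (r + 1) (Or.inr ⟨by omega, by omega, rfl⟩)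
      omega
    have hi : Set.InjOn f (Yng p (p + (u + 1)) (r + 1) (r + 1 + v)) := by
      rintro a ⟨h1, -⟩ b ⟨h1', -⟩ hab
      refine ext2 fun i j => ?_
      have := app2 hab i j
      simp only [hf] at this
      grind
    rw [key, Set.encard_union_eq hd, hi.encard_image, ih u (v + 1) (p + 1) r (by omega),
      ih (u + 1) v p (r + 1) (by omega)]
    norm_cast
    have := Nat.choose_succ_succ (u + v + 1) u
    rw [show u + 1 + (v + 1) = u + v + 1 + 1 by ring, show u + (v + 1) = u + v + 1 by ring,
      show u + 1 + v = u + v + 1 by ring]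
    exact this.symm

lemma ss_zero (n : ℕ) : SS 0 n = Inc 0 n := by
  ext a
  constructor
  · rintro ⟨h, h1, h2⟩
    refine ⟨h, fun i => ?_⟩
    rcases Nat.eq_zero_or_pos i with rfl | hi
    · intro j j' _ _ _ h'
      have := h.2.2 _ _ h'
      omega
    · exact h2 i hi
  · rintro ⟨h, h1⟩
    refine ⟨h, ?_, fun i _ => h1 i⟩
    intro i hi j j' _ _ _ h'
    have := h.2.2 _ _ h'
    omega

lemma ss_card (u v : ℕ) : (SS (u + 1) (u + 1 + v + 1)).encard =
    ((2 ^ (u + v) + Nat.choose (u + v + 2) (u + 1) - 1 : ℕ) : ℕ∞) := by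
  obtain ⟨k, hk⟩ : ∃ k, k = u + 1 := ⟨_, rfl⟩
  rw [← hk]
  obtain ⟨n, hn⟩ : ∃ n, n = k + v + 1 := ⟨_, rfl⟩
  rw [← hn]
  set Y' : Set Rel := {b | b ∈ Yng 0 k k n ∧ b k (k + 1)} with hY'
  set f : Rel × Rel → Rel := fun x i j => x.1 i j ∨ x.2 i j with hf
  set g : Rel → Rel := fun b i j => b i j ∨ b j i ∨
    (0 < i ∧ i ≤ k ∧ 0 < j ∧ j ≤ k ∧ i ≠ j) ∨ (k < i ∧ i ≤ n ∧ k < j ∧ j ≤ n ∧ i ≠ j) with hg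
  have hYc : Y'.encard + 1 = ((Nat.choose (u + v + 2) k : ℕ) : ℕ∞) := by
    have h0 : Yng 0 k k n = Y' ∪ {fun _ _ => False} := by
      ext b
      constructor
      · intro hb
        by_cases h : b k (k + 1)
        · left; exact ⟨hb, h⟩
        · right
          obtain ⟨h1, h2, h3⟩ := hb
          refine ext2 fun i j => ⟨fun hij => h ?_, False.elim⟩
          have := h1 _ _ hij
          have e : b k j := by
            rcases Nat.lt_or_ge i k with h' | h'
            · exact h3 i k j h' le_rfl hij
            · have : i = k := by omega
              rw [← this]; exact hij
          rcases Nat.lt_or_ge (k + 1) j with h' | h'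
          · exact h2 _ _ _ (by omega) h' e
          · have : j = k + 1 := by omega
            rw [← this]; exact e
      · rintro (h | h)
        · exact h.1
        · rw [Set.mem_singleton_iff] at h
          subst h
          exact ⟨by simp, by simp, by simp⟩
    have hd : Disjoint Y' {fun _ _ => False} := by
      rw [Set.disjoint_singleton_right]
      rintro ⟨-, h⟩; exact h
    have h1 := yng_card (u + 1 + (v + 1)) (u + 1) (v + 1) 0 k rfl
    rw [show 0 + (u + 1) = k by omega, show k + (v + 1) = n by omega, h0, Set.encard_union_eq hd,
      Set.encard_singleton, show u + 1 + (v + 1) = u + v + 2 by ring] at h1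
    rw [hk]; exact h1
  have key : SS k n = f '' (Dec 0 k ×ˢ Inc k n) ∪ g '' Y' := by
    ext a
    constructor
    · rintro ⟨⟨h1, h2, h3⟩, h4, h5⟩
      have h3' : ∀ i j, a i j → 0 < j ∧ j ≤ n := fun i j h => h3 _ _ (h1 _ _ h)
      by_cases h : a k (k + 1)
      · right
        have eA0 : ∀ i, 0 < i → i < k → a i k := by
          intro i b1 b2
          exact h1 _ _ (h4 k le_rfl i (k + 1) b1 (by omega) (by omega) h)
        have eA : ∀ i j, 0 < i → i ≤ k → 0 < j → j ≤ k → i ≠ j → a i j := by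
          intro i j b1 b2 b3 b4 b5
          rcases Nat.lt_or_ge i k with c | c
          · rcases Nat.lt_or_ge j k with d | d
            · exact h4 i b2 j k b3 d (by omega) (eA0 i b1 c)
            · have : j = k := by omega
              subst this; exact eA0 i b1 c
          · have : i = k := by omega
            subst this; exact h1 _ _ (eA0 j b3 (by omega))
        have eD0 : ∀ i, k + 1 < i → i ≤ n → a i (k + 1) := by
          intro i b1 b2
          exact h1 _ _ (h5 (k + 1) (by omega) k i (by omega) b2 (by omega) (h1 _ _ h))
        have eD : ∀ i j, k < i → i ≤ n → k < j → j ≤ n → i ≠ j → a i j := by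
          intro i j b1 b2 b3 b4 b5
          rcases Nat.lt_or_ge (k + 1) i with c | c
          · rcases Nat.lt_or_ge (k + 1) j with d | d
            · exact h5 i b1 (k + 1) j d b4 (by omega) (eD0 i c b2)
            · have : j = k + 1 := by omega
              subst this; exact eD0 i c b2
          · have : i = k + 1 := by omega
            subst this; exact h1 _ _ (eD0 j (by omega) b4)
        refine ⟨fun i j => a i j ∧ i ≤ k ∧ k < j, ⟨⟨?_, ?_, ?_⟩, ?_⟩, ?_⟩
        · intro i j hij
          have := h3 _ _ hij.1
          have := h3' _ _ hij.1
          omega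
        · rintro i j j' b1 b2 ⟨b3, b4, b5⟩
          exact ⟨h4 i b4 j j' (by omega) b2 (by omega) b3, b4, b1⟩
        · rintro i i' j b1 b2 ⟨b3, b4, b5⟩
          exact ⟨h1 _ _ (h5 j b5 i i' b1 (by omega) (by omega) (h1 _ _ b3)), b2, b5⟩
        · exact ⟨h, le_rfl, by omega⟩
        · refine ext2 fun i j => ?_
          simp only [hg]
          constructor
          · rintro (c | c | ⟨c1, c2, c3, c4, c5⟩ | ⟨c1, c2, c3, c4, c5⟩)
            · exact c.1
            · exact h1 _ _ c.1
            · exact eA i j c1 c2 c3 c4 c5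
            · exact eD i j c1 c2 c3 c4 c5
          · intro hij
            have := h3 _ _ hij
            have := h3' _ _ hij
            have : i ≠ j := by rintro rfl; exact h2 _ hij
            have := h1 _ _ hij
            rcases Nat.lt_or_ge k i with c | c <;> rcases Nat.lt_or_ge k j with d | d
            · right; right; right; omega
            · right; left; exact ⟨this, d, c⟩
            · left; exact ⟨hij, c, d⟩
            · right; right; left; omega
      · left
        have eB : ∀ i j, i ≤ k → k < j → ¬ a i j := by
          intro i j b1 b2 hij
          have := h3' _ _ hij
          apply h
          have e : a k j := by
            rcases Nat.lt_or_ge i k with h' | h'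
            · exact h1 _ _ (h5 j b2 i k h' (by omega) (by omega) (h1 _ _ hij))
            · have : i = k := by omega
              rw [← this]; exact hij
          rcases Nat.lt_or_ge (k + 1) j with h' | h'
          · exact h4 k le_rfl _ _ (by omega) h' (by omega) e
          · have : j = k + 1 := by omega
            rw [← this]; exact e
        refine ⟨(fun i j => a i j ∧ i ≤ k, fun i j => a i j ∧ k < i), ⟨⟨⟨?_, ?_, ?_⟩, ?_⟩, ⟨?_, ?_, ?_⟩, ?_⟩, ?_⟩
        · rintro i j ⟨b1, b2⟩
          refine ⟨h1 _ _ b1, ?_⟩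
          by_contra hc
          exact eB i j b2 (by omega) b1
        · rintro i ⟨b1, b2⟩; exact h2 _ b1
        · rintro i j ⟨b1, b2⟩; exact ⟨(h3 _ _ b1).1, b2⟩
        · rintro i j j' b1 b2 b3 ⟨b4, b5⟩
          exact ⟨h4 i b5 j j' b1 b2 b3 b4, b5⟩
        · rintro i j ⟨b1, b2⟩
          refine ⟨h1 _ _ b1, ?_⟩
          by_contra hc
          exact eB j i (by omega) b2 (h1 _ _ b1)
        · rintro i ⟨b1, b2⟩; exact h2 _ b1
        · rintro i j ⟨b1, b2⟩; exact ⟨b2, (h3 _ _ b1).2⟩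
        · rintro i j j' b1 b2 b3 ⟨b4, b5⟩
          exact ⟨h5 i b5 j j' b1 b2 b3 b4, b5⟩
        · refine ext2 fun i j => ?_
          simp only [hf]
          have := Nat.lt_or_ge k i
          tauto
    · rintro (⟨⟨A, D⟩, ⟨⟨⟨h1, h2, h3⟩, h4⟩, ⟨⟨h1', h2', h3'⟩, h4'⟩⟩, rfl⟩ | ⟨b, ⟨⟨h1, h2, h3⟩, h4⟩, rfl⟩)
      · dsimp only at h1 h2 h3 h4 h1' h2' h3' h4'
        simp only [hf]
        refine ⟨⟨?_, ?_, ?_⟩, ?_, ?_⟩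
        · grind
        · grind
        · grind
        · intro i hi j j' b1 b2 b3 b4
          have := h4 i j j' b1 b2 b3
          have := h3' i j'
          grind
        · intro i hi j j' b1 b2 b3 b4
          have := h4' i j j' b1 b2 b3
          have := h3 i j
          grind
      · simp only [hg]
        refine ⟨⟨?_, ?_, ?_⟩, ?_, ?_⟩
        · grind
        · grind
        · grind
        · intro i hi j j' b1 b2 b3 b4
          have e1 := h2 i j j'
          have e2 := h1 i j'
          have e3 := h1 j' i
          rcases b4 with c | c | c | c
          · have := e2 c
            rcases Nat.lt_or_ge k j with d | d
            · left; exact e1 d b2 c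
            · right; right; left; omega
          · have := e3 c; omega
          · right; right; left; omega
          · omega
        · intro i hi j j' b1 b2 b3 b4
          have e1 := h3 j j' i
          have e2 := h1 i j
          have e3 := h1 j i
          rcases b4 with c | c | c | c
          · have := e2 c; omega
          · have := e3 c
            rcases Nat.lt_or_ge k j' with d | d
            · right; right; right; omega
            · right; left; exact e1 b1 d c
          · omega
          · right; right; right; omega
  have hd : Disjoint (f '' (Dec 0 k ×ˢ Inc k n)) (g '' Y') := by
    rw [Set.disjoint_left]
    rintro _ ⟨⟨A, D⟩, ⟨⟨⟨h1, h2, h3⟩, h4⟩, ⟨⟨h1', h2', h3'⟩, h4'⟩⟩, rfl⟩ ⟨b, ⟨-, hb⟩, hbb⟩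
    have : f (A, D) k (k + 1) := by rw [← hbb]; left; exact hb
    rcases this with c | c
    · have := h3 _ _ (h1 _ _ c); omega
    · have := h3' _ _ c; omega
  have hif : Set.InjOn f (Dec 0 k ×ˢ Inc k n) := by
    rintro ⟨A, D⟩ ⟨⟨⟨h1, h2, h3⟩, -⟩, ⟨⟨h1', h2', h3'⟩, -⟩⟩ ⟨A', D'⟩ ⟨⟨⟨g1, g2, g3⟩, -⟩, ⟨⟨g1', g2', g3'⟩, -⟩⟩ hab
    dsimp only at *
    refine Prod.ext (ext2 fun i j => ?_) (ext2 fun i j => ?_)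
    all_goals
      have := app2 hab i j
      simp only [hf] at this
      have := h3 i j
      have := h3' i j
      have := g3 i j
      have := g3' i j
      dsimp only
      grind
  have hig : Set.InjOn g Y' := by
    rintro a ⟨⟨h1, -⟩, -⟩ b ⟨⟨h1', -⟩, -⟩ hab
    refine ext2 fun i j => ?_
    have := app2 hab i j
    simp only [hg] at this
    have := h1 i j
    have := h1 j i
    have := h1' i j
    have := h1' j i
    grind
  have hDec := dec_card u 0
  have hInc := inc_card v k
  rw [← hn] at hInc
  rw [show 0 + u + 1 = k by omega] at hDec
  have hc : 0 < Nat.choose (u + v + 2) k := Nat.choose_pos (by omega)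
  have hY : Y'.encard = ((Nat.choose (u + v + 2) k - 1 : ℕ) : ℕ∞) := by
    have h2 : Y'.encard + 1 = ((Nat.choose (u + v + 2) k - 1 : ℕ) : ℕ∞) + 1 := by
      rw [hYc]
      norm_cast
      omega
    exact (ENat.add_left_injective_of_ne_top (by simp) h2)
  rw [key, Set.encard_union_eq hd, hif.encard_image, hig.encard_image, Set.encard_prod, hDec, hInc, hY]
  norm_cast
  rw [pow_add]
  omega

def ext (n k : ℕ) (a : Rel) : Rel := fun i j =>
  a i j ∨ (i = n + 1 ∧ k < j ∧ j ≤ n) ∨ (j = n + 1 ∧ k < i ∧ i ≤ n)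

def UU (n t : ℕ) : Set Rel := {a | ∃ k < t, ∃ b ∈ SS k n, ext n k b = a}

lemma ext_row {n k : ℕ} {a : Rel} (ha : Sup 0 n a) (j : ℕ) :
    ext n k a (n + 1) j ↔ (k < j ∧ j ≤ n) := by
  have := ha.2.2 (n + 1) j
  simp only [ext]
  grind

lemma uu_card (n : ℕ) (s : ℕ → ℕ) (t : ℕ) (ht : t ≤ n)
    (hs : ∀ k < t, (SS k n).encard = (s k : ℕ∞)) :
    (UU n t).encard = ((∑ k ∈ Finset.range t, s k : ℕ) : ℕ∞) := by
  induction t with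
  | zero => simp [UU]
  | succ t ih =>
    have key : UU n (t + 1) = UU n t ∪ ext n t '' SS t n := by
      ext a
      constructor
      · rintro ⟨k, hk, b, hb, rfl⟩
        rcases Nat.lt_or_ge k t with h | h
        · left; exact ⟨k, h, b, hb, rfl⟩
        · have : k = t := by omega
          subst this
          right; exact ⟨b, hb, rfl⟩
      · rintro (⟨k, hk, h⟩ | ⟨b, hb, rfl⟩)
        · exact ⟨k, by omega, h⟩
        · exact ⟨t, by omega, b, hb, rfl⟩
    have hd : Disjoint (UU n t) (ext n t '' SS t n) := by
      rw [Set.disjoint_left]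
      rintro _ ⟨k, hk, b, hb, rfl⟩ ⟨c, hc, h⟩
      have h1 := app2 h (n + 1) t
      rw [ext_row hb.1, ext_row hc.1] at h1
      omega
    have hi : Set.InjOn (ext n t) (SS t n) := by
      rintro a ⟨⟨h1, h2, h3⟩, -⟩ b ⟨⟨h1', h2', h3'⟩, -⟩ hab
      refine ext2 fun i j => ?_
      have := app2 hab i j
      simp only [ext] at this
      have := h3 i j
      have := h3' i j
      have := h3 j i
      have := h3' j i
      have := h1 i j
      have := h1' i j
      grind
    rw [key, Set.encard_union_eq hd, hi.encard_image, ih (by omega) (fun k hk => hs k (by omega)),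
      hs t (by omega), Finset.sum_range_succ]
    norm_cast

def cpl (n : ℕ) (a : Rel) : Rel := fun i j =>
  (0 < i ∧ i ≤ n ∧ 0 < j ∧ j ≤ n ∧ i ≠ j) ∧ ¬ a i j

lemma cpl_cpl {n : ℕ} {a : Rel} (h : Sup 0 n a) : cpl n (cpl n a) = a := by
  obtain ⟨h1, h2, h3⟩ := h
  refine ext2 fun i j => ?_
  simp only [cpl]
  have := h3 i j
  have := h1 i j
  have := h3 j i
  have := h2 i
  grind

lemma cpl_mem {n : ℕ} {a : Rel} (h : a ∈ FF n) : cpl n a ∈ FF n := by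
  obtain ⟨⟨h1, h2, h3⟩, h4⟩ := h
  refine ⟨⟨?_, ?_, ?_⟩, ?_⟩
  · rintro i j ⟨h, h'⟩
    exact ⟨by omega, fun h'' => h' (h1 _ _ h'')⟩
  · rintro i ⟨h, h'⟩
    omega
  · rintro i j ⟨h, h'⟩
    omega
  · intro i hi hi'
    rcases h4 i hi hi' with h | h
    · right
      rintro j j' b1 b2 b3 ⟨b4, b5⟩
      exact ⟨by omega, fun h' => b5 (h j j' (by omega) b1 (by omega) h')⟩
    · left
      rintro j j' b1 b2 b3 ⟨b4, b5⟩
      exact ⟨by omega, fun h' => b5 (h j j' b2 (by omega) (by omega) h')⟩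

lemma ff_half (n : ℕ) (hn : 0 < n) : {a | a ∈ FF (n + 1) ∧ a (n + 1) n} = UU n n := by
  ext a
  constructor
  · rintro ⟨⟨⟨h1, h2, h3⟩, h4⟩, h⟩
    have hk : ∃ k < n, ∀ j, a (n + 1) j ↔ (k < j ∧ j ≤ n) := by
      have hle : ∀ j, a (n + 1) j → 0 < j ∧ j ≤ n := by
        intro j hj
        have := h3 _ _ (h1 _ _ hj)
        have : j ≠ n + 1 := by rintro rfl; exact h2 _ hj
        omega
      rcases h4 (n + 1) (by omega) le_rfl with hr | hr
      · refine ⟨0, hn, fun j => ⟨hle j, fun hj => ?_⟩⟩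
        rcases Nat.lt_or_ge j n with h' | h'
        · exact hr j n hj.1 h' (by omega) h
        · have : j = n := by omega
          rw [this]; exact h
      · classical
        have hex : ∃ j, a (n + 1) j := ⟨n, h⟩
        have hf := Nat.find_spec hex
        have hl := hle _ hf
        refine ⟨Nat.find hex - 1, by omega, fun j => ⟨fun hj => ?_, fun hj => ?_⟩⟩
        · have := Nat.find_min' hex hj
          have := hle _ hj
          omega
        · rcases Nat.lt_or_ge (Nat.find hex) j with h' | h'
          · exact hr _ j h' (by omega) (by omega) hf
          · have : j = Nat.find hex := by omega
            rw [this]; exact hf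
    obtain ⟨k, hkn, hk⟩ := hk
    have hk' : ∀ i, a i (n + 1) ↔ (k < i ∧ i ≤ n) := fun i =>
      ⟨fun h => (hk i).1 (h1 _ _ h), fun h => h1 _ _ ((hk i).2 h)⟩
    refine ⟨k, hkn, fun i j => a i j ∧ i ≤ n ∧ j ≤ n, ⟨⟨?_, ?_, ?_⟩, ?_, ?_⟩, ?_⟩
    · grind
    · grind
    · grind
    · rintro i hi j j' b1 b2 b3 ⟨b4, b5, b6⟩
      have := h3 _ _ b4
      rcases h4 i (by omega) (by omega) with hr | hr
      · exact ⟨hr j j' b1 b2 b3 b4, by omega, by omega⟩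
      · have := hr j' (n + 1) (by omega) le_rfl (by omega) b4
        rw [hk'] at this
        omega
    · rintro i hi j j' b1 b2 b3 ⟨b4, b5, b6⟩
      rcases h4 i (by omega) (by omega) with hr | hr
      · exact ⟨hr j' (n + 1) (by omega) (by omega) (by omega) ((hk' i).2 ⟨hi, b5⟩), by omega, by omega⟩
      · exact ⟨hr j j' b1 (by omega) b3 b4, by omega, by omega⟩
    · refine ext2 fun i j => ?_
      simp only [ext]
      have := hk j
      have := hk' i
      have := h3 i j
      have := h3 j i
      have := h1 i j
      grind
  · rintro ⟨k, hk, a, ⟨⟨h1, h2, h3⟩, h4, h5⟩, rfl⟩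
    refine ⟨⟨⟨?_, ?_, ?_⟩, ?_⟩, ?_⟩
    · simp only [ext]; grind
    · simp only [ext]; grind
    · simp only [ext]; grind
    · intro i hi hi'
      rcases Nat.lt_or_ge k i with c | c
      · right
        intro j j' b1 b2 b3 b4
        have := h5 i c j j'
        have := h3 i j
        have := h3 j i
        have := h1 i j
        simp only [ext] at *
        grind
      · left
        intro j j' b1 b2 b3 b4
        have := h4 i c j j'
        have := h3 i j'
        have := h3 j' i
        have := h1 i j'
        simp only [ext] at *
        grind
    · rw [ext_row ⟨h1, h2, h3⟩]; omega

lemma ff_card (n : ℕ) (hn : 2 ≤ n) :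
    (FF (n + 1)).encard = ((2 ^ (n + 1) + (n + 1) * 2 ^ (n - 1) - 2 * (n + 1) : ℕ) : ℕ∞) := by
  obtain ⟨m, rfl⟩ : ∃ m, n = m + 2 := ⟨n - 2, by omega⟩
  set s : ℕ → ℕ := fun k => if k = 0 then 2 ^ (m + 1) else 2 ^ m + Nat.choose (m + 2) k - 1 with hs
  have hu := uu_card (m + 2) s (m + 2) le_rfl (by
    intro k hk
    rcases k with _ | u
    · rw [ss_zero]
      have := inc_card (m + 1) 0
      rw [show 0 + (m + 1) + 1 = m + 2 by omega] at this
      rw [this]; simp [hs]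
    · obtain ⟨v, hv⟩ : ∃ v, m = u + v := ⟨m - u, by omega⟩
      have := ss_card u v
      rw [show u + 1 + v + 1 = m + 2 by omega, ← hv] at this
      rw [this]; simp [hs])
  rw [← ff_half _ (by omega)] at hu
  set H : Set Rel := {a | a ∈ FF (m + 2 + 1) ∧ a (m + 2 + 1) (m + 2)} with hH
  have key : FF (m + 2 + 1) = H ∪ cpl (m + 2 + 1) '' H := by
    ext a
    constructor
    · intro h
      by_cases c : a (m + 2 + 1) (m + 2)
      · left; exact ⟨h, c⟩
      · right
        refine ⟨cpl _ a, ⟨cpl_mem h, ?_⟩, cpl_cpl h.1⟩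
        exact ⟨by omega, c⟩
    · rintro (h | ⟨b, h, rfl⟩)
      · exact h.1
      · exact cpl_mem h.1
  have hd : Disjoint H (cpl (m + 2 + 1) '' H) := by
    rw [Set.disjoint_left]
    rintro _ ⟨-, h⟩ ⟨b, ⟨-, hb⟩, rfl⟩
    exact h.2 hb
  have hi : Set.InjOn (cpl (m + 2 + 1)) H := by
    rintro a ⟨ha, -⟩ b ⟨hb, -⟩ hab
    rw [← cpl_cpl ha.1, ← cpl_cpl hb.1, hab]
  have hsum : ∑ k ∈ Finset.range (m + 2), s k + (m + 1) + 2 =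
      2 ^ (m + 1) + (m + 1) * 2 ^ m + 2 ^ (m + 2) := by
    have h1 := Nat.sum_range_choose (m + 2)
    rw [Finset.sum_range_succ, Finset.sum_range_succ'] at h1
    rw [Finset.sum_range_succ']
    have h2 : ∑ k ∈ Finset.range (m + 1), s (k + 1) + (m + 1) =
        (m + 1) * 2 ^ m + ∑ k ∈ Finset.range (m + 1), Nat.choose (m + 2) (k + 1) := by
      have : ∑ k ∈ Finset.range (m + 1), (s (k + 1) + 1) =
          ∑ k ∈ Finset.range (m + 1), (2 ^ m + Nat.choose (m + 2) (k + 1)) := by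
        refine Finset.sum_congr rfl fun k hk => ?_
        have : 0 < 2 ^ m := by positivity
        simp only [hs]
        rw [if_neg (by omega)]
        omega
      simpa [Finset.sum_add_distrib] using this
    have h3 : s 0 = 2 ^ (m + 1) := by simp [hs]
    simp only [Nat.choose_self, Nat.choose_zero_right] at h1
    omega
  rw [key, Set.encard_union_eq hd, hi.encard_image, hu]
  norm_cast
  rw [show m + 2 - 1 = m + 1 by omega]
  have e1 : (m + 2 + 1) * 2 ^ (m + 1) = 2 * ((m + 1) * 2 ^ m) + 4 * 2 ^ m := by ring
  rw [e1]
  have e2 : 2 ^ (m + 1) = 2 * 2 ^ m := by ring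
  have e3 : 2 ^ (m + 2) = 4 * 2 ^ m := by ring
  have e4 : 2 ^ (m + 2 + 1) = 8 * 2 ^ m := by ring
  omega

lemma lex_iff {i j j' : ℕ} (h : j ≠ i) (h' : j' ≠ i) :
    lexLt (insert j {i}) (insert j' {i}) ↔ j < j' := by
  simp only [lexLt, Finset.mem_insert, Finset.mem_singleton]
  constructor
  · rintro ⟨m, h1, h2, h3⟩
    have hm : m = j := by tauto
    subst hm
    by_contra hc
    have := h3 j' (by omega)
    omega
  · intro hl
    refine ⟨j, Or.inl rfl, by omega, ?_⟩
    intro a ha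
    omega

def toRel (J : Finset (Finset ℕ)) : Rel := fun i j => i ≠ j ∧ ({j, i} : Finset ℕ) ∈ J

lemma mem_ks {n : ℕ} {i j : ℕ} (hij : i ≠ j) :
    ({j, i} : Finset ℕ) ∈ ksubsets n 2 ↔ (0 < i ∧ i ≤ n ∧ 0 < j ∧ j ≤ n) := by
  simp only [ksubsets, Finset.mem_powersetCard, Finset.insert_subset_iff,
    Finset.singleton_subset_iff, Finset.mem_Icc, Finset.card_pair hij.symm]
  constructor
  · rintro ⟨⟨h1, h2⟩, -⟩
    omega
  · intro h
    exact ⟨⟨by omega, by omega⟩, trivial⟩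

lemma row_iff {n : ℕ} {J : Finset (Finset ℕ)} (hJ : J ⊆ ksubsets n 2) {i : ℕ} :
    (IsLexPrefix (copacket n {i}) J ↔ DecRow 0 i (toRel J)) ∧
    (IsLexSuffix (copacket n {i}) J ↔ IncRow n i (toRel J)) := by
  have hm : ∀ A, A ∈ copacket n {i} ↔ ∃ j, (0 < j ∧ j ≤ n) ∧ j ≠ i ∧ insert j {i} = A := by
    intro A
    simp only [copacket, Finset.mem_image, Finset.mem_sdiff, Finset.mem_Icc, Finset.mem_singleton]
    constructor
    · rintro ⟨j, h, h'⟩; exact ⟨j, by omega, by omega, h'⟩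
    · rintro ⟨j, h, h', h''⟩; exact ⟨j, by omega, h''⟩
  have hr : ∀ j, toRel J i j → 0 < j ∧ j ≤ n := by
    rintro j ⟨h, h'⟩
    have := (mem_ks h).1 (hJ h')
    omega
  constructor
  · constructor
    · intro h j j' b1 b2 b3 b4
      have := hr _ b4
      refine ⟨b3.symm, h _ ((hm _).2 ⟨j, by omega, b3, rfl⟩) _
        ((hm _).2 ⟨j', by omega, b4.1.symm, rfl⟩) b4.2 ((lex_iff b3 b4.1.symm).2 b2)⟩
    · intro h A hA B hB hBJ hl
      obtain ⟨j, c1, c2, rfl⟩ := (hm _).1 hA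
      obtain ⟨j', d1, d2, rfl⟩ := (hm _).1 hB
      exact (h j j' c1.1 ((lex_iff c2 d2).1 hl) c2 ⟨d2.symm, hBJ⟩).2
  · constructor
    · intro h j j' b1 b2 b3 b4
      have := hr _ b4
      refine ⟨b3.symm, h _ ((hm _).2 ⟨j, by omega, b4.1.symm, rfl⟩) _
        ((hm _).2 ⟨j', by omega, b3, rfl⟩) b4.2 ((lex_iff b4.1.symm b3).2 b1)⟩
    · intro h A hA B hB hBJ hl
      obtain ⟨j, c1, c2, rfl⟩ := (hm _).1 hA
      obtain ⟨j', d1, d2, rfl⟩ := (hm _).1 hB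
      exact (h j j' ((lex_iff c2 d2).1 hl) d1.2 d2 ⟨c2.symm, hBJ⟩).2

lemma coc_iff {n : ℕ} {J : Finset (Finset ℕ)} (hJ : J ⊆ ksubsets n 2) :
    CoConsistent n 2 J ↔ toRel J ∈ FF n := by
  have hs : Sup 0 n (toRel J) := by
    refine ⟨?_, ?_, ?_⟩
    · rintro i j ⟨h, h'⟩
      exact ⟨h.symm, by rwa [Finset.pair_comm]⟩
    · rintro i ⟨h, -⟩; exact h rfl
    · rintro i j ⟨h, h'⟩
      have := (mem_ks h).1 (hJ h')
      omega
  constructor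
  · rintro ⟨-, h⟩
    refine ⟨hs, fun i hi hi' => ?_⟩
    rw [← (row_iff hJ).1, ← (row_iff hJ).2]
    apply h
    simp only [ksubsets, Finset.mem_powersetCard, Finset.singleton_subset_iff, Finset.mem_Icc]
    exact ⟨by omega, by simp⟩
  · rintro ⟨-, h⟩
    refine ⟨hJ, fun X hX => ?_⟩
    simp only [ksubsets, Finset.mem_powersetCard] at hX
    obtain ⟨i, rfl⟩ := Finset.card_eq_one.1 (by simpa using hX.2)
    have := hX.1
    simp only [Finset.singleton_subset_iff, Finset.mem_Icc] at this
    rw [(row_iff hJ).1, (row_iff hJ).2]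
    exact h i (by omega) this.2

lemma coc_card (n : ℕ) : Nat.card {J : Finset (Finset ℕ) // CoConsistent n 2 J} = (FF n).ncard := by
  have key : FF n = toRel '' {J | CoConsistent n 2 J} := by
    ext a
    constructor
    · intro ha
      classical
      set J := (ksubsets n 2).filter (fun X => ∃ i j, i ≠ j ∧ X = {j, i} ∧ a i j) with hJ
      have hsub : J ⊆ ksubsets n 2 := Finset.filter_subset _ _
      have e : toRel J = a := by
        obtain ⟨⟨h1, h2, h3⟩, -⟩ := ha
        refine ext2 fun i j => ⟨?_, fun h => ?_⟩
        · rintro ⟨h, h'⟩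
          obtain ⟨-, i', j', c1, c2, c3⟩ := Finset.mem_filter.1 h'
          have e1 : i ∈ ({j', i'} : Finset ℕ) := by rw [← c2]; simp
          have e2 : j ∈ ({j', i'} : Finset ℕ) := by rw [← c2]; simp
          simp only [Finset.mem_insert, Finset.mem_singleton] at e1 e2
          have := h1 _ _ c3
          rcases e1 with rfl | rfl <;> rcases e2 with rfl | rfl <;> first | assumption | exact absurd rfl h
        · have hne : i ≠ j := by rintro rfl; exact h2 _ h
          have := h3 _ _ h
          have := h3 _ _ (h1 _ _ h)
          exact ⟨hne, Finset.mem_filter.2 ⟨(mem_ks hne).2 (by omega), i, j, hne, rfl, h⟩⟩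
      exact ⟨J, (coc_iff hsub).2 (by rwa [e]), e⟩
    · rintro ⟨J, hJ, rfl⟩
      exact (coc_iff hJ.1).1 hJ
  have hi : Set.InjOn toRel {J | CoConsistent n 2 J} := by
    rintro J hJ K hK h
    have : ∀ J K : Finset (Finset ℕ), J ⊆ ksubsets n 2 → toRel J = toRel K → J ⊆ K := by
      intro J K hJ h X hX
      have h2 := hJ hX
      simp only [ksubsets, Finset.mem_powersetCard] at h2
      obtain ⟨x, y, hxy, rfl⟩ := Finset.card_eq_two.1 h2.2
      exact ((app2 h y x).1 ⟨hxy.symm, hX⟩).2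
    exact Finset.Subset.antisymm (this _ _ hJ.1 h) (this _ _ hK.1 h.symm)
  rw [key, hi.ncard_image]
  exact Nat.card_coe_set_eq _

end CoC

/-- For `n ≥ 4`, the number of coconsistent subsets of the `2`-element
subsets of `[n]` equals `2^n + n·2^(n-2) - 2n` (which is `|B(n, n-3)|`). -/
theorem coconsistent_two_subsets_count (n : ℕ) (hn : 4 ≤ n) :
    Nat.card {J : Finset (Finset ℕ) // CoConsistent n 2 J} =
      2 ^ n + n * 2 ^ (n - 2) - 2 * n := by
  obtain ⟨m, rfl⟩ : ∃ m, n = m + 1 := ⟨n - 1, by omega⟩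
  rw [CoC.coc_card, Set.ncard, CoC.ff_card m (by omega)]
  rfl
end
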